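/- Let 0 < p, q, u, v ≤ ∞. Then there exist constants c, C > 0 depending only on p, q, u, v such that for all n ∈ ℕ the operator norm ‖id: ℓ_{p,u}^n → ℓ_{q,v}^n‖ = sup{‖x‖_{q,v} : ‖x‖_{p,u} ≤ 1} satisfies: (i) if p ≠ q and p, q < ∞, then c · n^{(1/q − 1/p)_+} ≤ ‖id‖ ≤ C · n^{(1/q − 1/p)_+}; (ii) if q < p = ∞, then c · n^{1/q}(log(n+1))^{−1/u} ≤ ‖id‖ ≤ C · n^{1/q}(log(n+1))^{−1/u}; (iii) if p < q = ∞, then c ≤ ‖id‖ ≤ C; (iv) if p = q, then c · (log(n+1))^{(1/v − 1/u)_+} ≤ ‖id‖ ≤ C · (log(n+1))^{(1/v − 1/u)_+}. Here (x)_+ = max{0, x}. -/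

import Mathlib

open scoped ENNReal Classical
open MeasureTheory

/-- The non-increasing rearrangement of `x : ℝ^n`: for `1 ≤ i ≤ n`,
`rearr n x i` is the `i`-th largest of the absolute values of the entries of `x`,
defined via `x_i^* = inf {t ≥ 0 : #{j : |x j| > t} ≤ i - 1}`. -/
noncomputable def rearr (n : ℕ) (x : Fin n → ℝ) (i : ℕ) : ℝ :=
  sInf {t : ℝ | 0 ≤ t ∧ ((Finset.univ : Finset (Fin n)).filter (fun j => t < |x j|)).card ≤ i - 1}

/-- The Lorentz quasi-norm `‖x‖_{p,u}` on `ℝ^n` for `p, u ∈ (0,∞]`, with the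
convention `1/∞ = 0`:  `‖x‖_{p,u} = (∑_{i=1}^n i^{u/p-1} (x_i^*)^u)^{1/u}` for `u < ∞`
and `‖x‖_{p,∞} = max_{1 ≤ i ≤ n} i^{1/p} x_i^*`. -/
noncomputable def lorentzNorm (n : ℕ) (p u : ℝ≥0∞) (x : Fin n → ℝ) : ℝ :=
  if u = ⊤ then
    sSup {t : ℝ | ∃ i ∈ Finset.Icc 1 n, t = (i : ℝ) ^ (1 / p).toReal * rearr n x i}
  else
    (∑ i ∈ Finset.Icc 1 n, (i : ℝ) ^ ((u / p).toReal - 1) * rearr n x i ^ u.toReal) ^ (1 / u.toReal)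

/-- The `k`-th (dyadic) entropy number of the identity map from `(ℝ^n, NX)` to `(ℝ^n, NY)`:
`e_k = inf {ε > 0 : ∃ y_1, …, y_{2^{k-1}} with B_X ⊆ ⋃ (y_i + ε B_Y)}`. -/
noncomputable def entropyNumber (n : ℕ) (NX NY : (Fin n → ℝ) → ℝ) (k : ℕ) : ℝ :=
  sInf {ε : ℝ | 0 < ε ∧ ∃ T : Finset (Fin n → ℝ), T.card ≤ 2 ^ (k - 1) ∧
    ∀ x : Fin n → ℝ, NX x ≤ 1 → ∃ y ∈ T, NY (x - y) ≤ ε}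

/-- The operator norm of the identity map from `(ℝ^n, NX)` to `(ℝ^n, NY)`:
`‖id‖ = sup {NY x : NX x ≤ 1}`. -/
noncomputable def opNorm (n : ℕ) (NX NY : (Fin n → ℝ) → ℝ) : ℝ :=
  sSup {t : ℝ | ∃ x : Fin n → ℝ, NX x ≤ 1 ∧ t = NY x}

/-- The `ℓ^u`-quasi-norm of `y_1, …, y_n` with respect to the weights `1 / i`. -/
noncomputable def weightedNorm (n : ℕ) (u : ℝ≥0∞) (y : ℕ → ℝ) : ℝ :=
  if u = ⊤ then sSup {t : ℝ | ∃ i ∈ Finset.Icc 1 n, t = y i}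
  else (∑ i ∈ Finset.Icc 1 n, (i : ℝ)⁻¹ * y i ^ u.toReal) ^ (1 / u.toReal)

lemma rearr_nonneg (n : ℕ) (x : Fin n → ℝ) (i : ℕ) : 0 ≤ rearr n x i :=
  Real.sInf_nonneg fun _ ht => ht.1

lemma lorentzNorm_eq_weightedNorm (n : ℕ) (p u : ℝ≥0∞) (x : Fin n → ℝ) :
    lorentzNorm n p u x =
      weightedNorm n u (fun i => (i : ℝ) ^ (1 / p).toReal * rearr n x i) := by
  unfold lorentzNorm weightedNorm
  split_ifs with h
  · rfl
  · congr 1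
    refine Finset.sum_congr rfl fun i hi => ?_
    have hi0 : (0 : ℝ) < i := by
      have := (Finset.mem_Icc.1 hi).1
      exact_mod_cast this
    rw [Real.mul_rpow (by positivity) (rearr_nonneg n x i), ← Real.rpow_mul hi0.le, ← mul_assoc,
      ← Real.rpow_neg_one, ← Real.rpow_add hi0]
    congr 2
    simp only [ENNReal.toReal_div, ENNReal.toReal_one]
    ring

lemma rearr_set_nonempty (n : ℕ) (x : Fin n → ℝ) (i : ℕ) :
    {t : ℝ | 0 ≤ t ∧
      ((Finset.univ : Finset (Fin n)).filter (fun j => t < |x j|)).card ≤ i - 1}.Nonempty := by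
  refine ⟨∑ j, |x j|, Finset.sum_nonneg fun j _ => abs_nonneg _, ?_⟩
  rw [Finset.filter_false_of_mem]
  · simp
  · intro j hj
    exact not_lt.2 (Finset.single_le_sum (f := fun j => |x j|) (fun j _ => abs_nonneg _) hj)

lemma rearr_antitone (n : ℕ) (x : Fin n → ℝ) : Antitone (rearr n x) := fun i _ hij =>
  csInf_le_csInf ⟨0, fun _ ht => ht.1⟩ (rearr_set_nonempty n x i)
    fun _ ht => ⟨ht.1, ht.2.trans (by omega)⟩

lemma rearr_of_antitone {n : ℕ} {f : ℕ → ℝ} (hf0 : ∀ i, 0 ≤ f i)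
    (hf : ∀ i j, 1 ≤ i → i ≤ j → f j ≤ f i) {i : ℕ} (hi : i ∈ Finset.Icc 1 n) :
    rearr n (fun j => f (j + 1)) i = f i := by
  obtain ⟨hi1, hin⟩ := Finset.mem_Icc.1 hi
  have hcard : ((Finset.univ : Finset (Fin n)).filter fun j : Fin n => (j : ℕ) < i - 1).card = i - 1 := by
    rw [Fin.card_filter_val_lt]
    omega
  have hcard' : ((Finset.univ : Finset (Fin n)).filter fun j : Fin n => (j : ℕ) < i).card = i := by
    rw [Fin.card_filter_val_lt]
    omega
  refine le_antisymm (csInf_le ⟨0, fun _ ht => ht.1⟩ ⟨hf0 i, ?_⟩)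
    (le_csInf (rearr_set_nonempty _ _ _) fun t ht => ?_)
  · rw [← hcard]
    refine Finset.card_le_card fun j hj => ?_
    simp only [Finset.mem_filter, Finset.mem_univ, true_and, abs_of_nonneg (hf0 _)] at hj ⊢
    by_contra! h
    exact absurd hj (not_lt.2 (hf i (j + 1) hi1 (by omega)))
  · by_contra! h
    have h1 : i ≤ i - 1 := by
      refine le_trans ?_ ht.2
      conv_lhs => rw [← hcard']
      refine Finset.card_le_card fun j hj => ?_
      simp only [Finset.mem_filter, Finset.mem_univ, true_and, abs_of_nonneg (hf0 _)] at hj ⊢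
      exact h.trans_le (hf (j + 1) i (by omega) (by omega))
    omega

section weightedNorm

variable {n : ℕ} {u : ℝ≥0∞} {y z : ℕ → ℝ}

lemma weightedNorm_nonneg (hy : ∀ i, 0 ≤ y i) : 0 ≤ weightedNorm n u y := by
  unfold weightedNorm
  split_ifs
  · exact Real.sSup_nonneg (by rintro _ ⟨i, -, rfl⟩; exact hy i)
  · exact Real.rpow_nonneg (Finset.sum_nonneg fun i _ =>
      mul_nonneg (by positivity) (Real.rpow_nonneg (hy i) _)) _

lemma weightedNorm_congr (h : ∀ i ∈ Finset.Icc 1 n, y i = z i) :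
    weightedNorm n u y = weightedNorm n u z := by
  unfold weightedNorm
  split_ifs
  · congr 1
    ext t
    exact ⟨fun ⟨i, hi, ht⟩ => ⟨i, hi, ht.trans (h i hi)⟩,
      fun ⟨i, hi, ht⟩ => ⟨i, hi, ht.trans (h i hi).symm⟩⟩
  · congr 1
    exact Finset.sum_congr rfl fun i hi => by rw [h i hi]

lemma le_weightedNorm_top {i : ℕ} (hi : i ∈ Finset.Icc 1 n) : y i ≤ weightedNorm n ⊤ y := by
  rw [weightedNorm, if_pos rfl]
  refine le_csSup (Set.Finite.bddAbove ?_) ⟨i, hi, rfl⟩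
  refine ((Finset.Icc 1 n).finite_toSet.image y).subset ?_
  rintro _ ⟨j, hj, rfl⟩
  exact ⟨j, hj, rfl⟩

lemma weightedNorm_top_le {B : ℝ} (hB : 0 ≤ B) (h : ∀ i ∈ Finset.Icc 1 n, y i ≤ B) :
    weightedNorm n ⊤ y ≤ B := by
  rw [weightedNorm, if_pos rfl]
  exact Real.sSup_le (by rintro _ ⟨i, hi, rfl⟩; exact h i hi) hB

lemma weightedNorm_of_ne_top (hu : u ≠ ⊤) : weightedNorm n u y =
    (∑ i ∈ Finset.Icc 1 n, (i : ℝ)⁻¹ * y i ^ u.toReal) ^ (1 / u.toReal) := by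
  rw [weightedNorm, if_neg hu]

lemma weightedNorm_sum_nonneg (hy : ∀ i, 0 ≤ y i) :
    0 ≤ ∑ i ∈ Finset.Icc 1 n, (i : ℝ)⁻¹ * y i ^ u.toReal :=
  Finset.sum_nonneg fun i _ => mul_nonneg (by positivity) (Real.rpow_nonneg (hy i) _)

lemma weightedNorm_mono (hy : ∀ i, 0 ≤ y i) (hz : ∀ i, 0 ≤ z i)
    (h : ∀ i ∈ Finset.Icc 1 n, y i ≤ z i) : weightedNorm n u y ≤ weightedNorm n u z := by
  by_cases hu : u = ⊤
  · subst hu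
    exact weightedNorm_top_le (weightedNorm_nonneg hz)
      fun i hi => (h i hi).trans (le_weightedNorm_top hi)
  · rw [weightedNorm_of_ne_top hu, weightedNorm_of_ne_top hu]
    refine Real.rpow_le_rpow (weightedNorm_sum_nonneg hy) ?_ (by positivity)
    exact Finset.sum_le_sum fun i hi => mul_le_mul_of_nonneg_left
      (Real.rpow_le_rpow (hy i) (h i hi) (by positivity)) (by positivity)

lemma weightedNorm_mul_le (hu : 0 < u) (hy : ∀ i, 0 ≤ y i) {c : ℝ} (hc : 0 ≤ c) :
    weightedNorm n u (fun i => c * y i) ≤ c * weightedNorm n u y := by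
  by_cases hut : u = ⊤
  · subst hut
    exact weightedNorm_top_le (mul_nonneg hc (weightedNorm_nonneg hy))
      fun i hi => mul_le_mul_of_nonneg_left (le_weightedNorm_top hi) hc
  · have hu' : 0 < u.toReal := ENNReal.toReal_pos hu.ne' hut
    rw [weightedNorm_of_ne_top hut, weightedNorm_of_ne_top hut]
    have : ∑ i ∈ Finset.Icc 1 n, (i : ℝ)⁻¹ * (c * y i) ^ u.toReal =
        c ^ u.toReal * ∑ i ∈ Finset.Icc 1 n, (i : ℝ)⁻¹ * y i ^ u.toReal := by
      rw [Finset.mul_sum]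
      refine Finset.sum_congr rfl fun i _ => ?_
      rw [Real.mul_rpow hc (hy i)]
      ring
    rw [this, Real.mul_rpow (by positivity) (weightedNorm_sum_nonneg hy), ← Real.rpow_mul hc,
      mul_one_div_cancel hu'.ne', Real.rpow_one]

lemma weightedNorm_mul (hu : 0 < u) (hy : ∀ i, 0 ≤ y i) {c : ℝ} (hc : 0 < c) :
    weightedNorm n u (fun i => c * y i) = c * weightedNorm n u y := by
  refine le_antisymm (weightedNorm_mul_le hu hy hc.le) ?_
  have h := weightedNorm_mul_le (n := n) hu (y := fun i => c * y i)
    (fun i => mul_nonneg hc.le (hy i)) (inv_nonneg.2 hc.le)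
  simp only [inv_mul_cancel_left₀ hc.ne'] at h
  rwa [← div_eq_inv_mul, le_div_iff₀' hc] at h

lemma weightedNorm_rpow (hu : 0 < u) (hut : u ≠ ⊤) (hy : ∀ i, 0 ≤ y i) :
    weightedNorm n u y ^ u.toReal = ∑ i ∈ Finset.Icc 1 n, (i : ℝ)⁻¹ * y i ^ u.toReal := by
  rw [weightedNorm_of_ne_top hut, ← Real.rpow_mul (weightedNorm_sum_nonneg hy),
    one_div_mul_cancel (ENNReal.toReal_pos hu.ne' hut).ne', Real.rpow_one]

lemma weightedNorm_one (hn : 0 < n) :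
    weightedNorm n u (fun _ => 1) = (∑ i ∈ Finset.Icc 1 n, (i : ℝ)⁻¹) ^ (1 / u).toReal := by
  by_cases hut : u = ⊤
  · subst hut
    simp only [ENNReal.div_top, ENNReal.toReal_zero, Real.rpow_zero]
    exact le_antisymm (weightedNorm_top_le zero_le_one fun _ _ => le_rfl)
      (le_weightedNorm_top (y := fun _ => 1) (i := 1) (Finset.mem_Icc.2 ⟨le_rfl, hn⟩))
  · rw [weightedNorm_of_ne_top hut]
    simp

lemma weightedNorm_indicator (hn : 0 < n) (hu : 0 < u) :
    weightedNorm n u (fun i => if i ≤ 1 then 1 else 0) = 1 := by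
  have h1 : 1 ∈ Finset.Icc 1 n := Finset.mem_Icc.2 ⟨le_rfl, hn⟩
  by_cases hut : u = ⊤
  · subst hut
    refine le_antisymm (weightedNorm_top_le zero_le_one fun i _ => ?_) ?_
    · split_ifs <;> norm_num
    · simpa using le_weightedNorm_top (y := fun i => if i ≤ 1 then (1 : ℝ) else 0) h1
  · have hu' : 0 < u.toReal := ENNReal.toReal_pos hu.ne' hut
    rw [weightedNorm_of_ne_top hut, Finset.sum_eq_single_of_mem 1 h1]
    · simp
    · intro i hi hne
      have : ¬ i ≤ 1 := by
        have := (Finset.mem_Icc.1 hi).1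
        omega
      simp [this, Real.zero_rpow hu'.ne']

end weightedNorm

lemma succ_rpow_sub_le (a : ℝ) (m : ℕ) (hm : 1 ≤ m) :
    ((m + 1 : ℕ) : ℝ) ^ a - (m : ℝ) ^ a ≤ max 1 a * ((m + 1 : ℕ) : ℝ) ^ (a - 1) := by
  have hM : (0 : ℝ) < (m + 1 : ℕ) := by positivity
  have hM1 : (1 : ℝ) ≤ (m + 1 : ℕ) := by push_cast; linarith [Nat.cast_nonneg (α := ℝ) m]
  have ht1 : ((m + 1 : ℕ) : ℝ)⁻¹ ≤ 1 := inv_le_one_of_one_le₀ hM1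
  have hm0 : (0 : ℝ) < m := by exact_mod_cast hm
  have hfac : (m : ℝ) = (m + 1 : ℕ) * (1 + -((m + 1 : ℕ) : ℝ)⁻¹) := by
    field_simp
    push_cast
    ring
  have hpos : 0 < 1 + -((m + 1 : ℕ) : ℝ)⁻¹ := by
    rw [hfac] at hm0
    exact pos_of_mul_pos_right hm0 hM.le
  have hbern : 1 - max 1 a * ((m + 1 : ℕ) : ℝ)⁻¹ ≤ (1 + -((m + 1 : ℕ) : ℝ)⁻¹) ^ a := by
    rcases le_total 1 a with h | h
    · rw [max_eq_right h]
      have := one_add_mul_self_le_rpow_one_add (s := -((m + 1 : ℕ) : ℝ)⁻¹) (by linarith) h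
      linarith
    · rw [max_eq_left h]
      have := Real.rpow_le_rpow_of_exponent_ge hpos (by linarith [inv_pos.2 hM]) h
      rw [Real.rpow_one] at this
      linarith
  rw [Real.rpow_sub_one hM.ne', div_eq_mul_inv]
  conv_lhs => rw [hfac, Real.mul_rpow hM.le hpos.le]
  have := mul_le_mul_of_nonneg_left hbern (Real.rpow_nonneg hM.le a)
  nlinarith

lemma le_succ_rpow_sub {a : ℝ} (ha : 0 < a) (m : ℕ) :
    min 1 a * ((m + 1 : ℕ) : ℝ) ^ (a - 1) ≤ ((m + 1 : ℕ) : ℝ) ^ a - (m : ℝ) ^ a := by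
  have hM : (0 : ℝ) < (m + 1 : ℕ) := by positivity
  have hM1 : (1 : ℝ) ≤ (m + 1 : ℕ) := by push_cast; linarith [Nat.cast_nonneg (α := ℝ) m]
  have ht1 : ((m + 1 : ℕ) : ℝ)⁻¹ ≤ 1 := inv_le_one_of_one_le₀ hM1
  have hfac : (m : ℝ) = (m + 1 : ℕ) * (1 + -((m + 1 : ℕ) : ℝ)⁻¹) := by
    field_simp
    push_cast
    ring
  have hpos : 0 ≤ 1 + -((m + 1 : ℕ) : ℝ)⁻¹ := by linarith
  have hbern : (1 + -((m + 1 : ℕ) : ℝ)⁻¹) ^ a ≤ 1 - min 1 a * ((m + 1 : ℕ) : ℝ)⁻¹ := by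
    rcases le_total 1 a with h | h
    · rw [min_eq_left h]
      have := Real.rpow_le_rpow_of_exponent_ge' hpos (by linarith [inv_pos.2 hM]) zero_le_one h
      rw [Real.rpow_one] at this
      linarith
    · rw [min_eq_right h]
      have := rpow_one_add_le_one_add_mul_self (s := -((m + 1 : ℕ) : ℝ)⁻¹) (by linarith) ha.le h
      linarith
  rw [Real.rpow_sub_one hM.ne', div_eq_mul_inv]
  conv_rhs => rw [hfac, Real.mul_rpow hM.le hpos]
  have := mul_le_mul_of_nonneg_left hbern (Real.rpow_nonneg hM.le a)
  nlinarith

lemma rpow_le_sum_rpow (a : ℝ) {m : ℕ} (hm : 1 ≤ m) :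
    (m : ℝ) ^ a ≤ max 1 a * ∑ i ∈ Finset.Icc 1 m, (i : ℝ) ^ (a - 1) := by
  induction m, hm using Nat.le_induction with
  | base => simp
  | succ m hm ih =>
    rw [Finset.sum_Icc_succ_top (by omega), mul_add]
    linarith [succ_rpow_sub_le a m hm]

lemma sum_rpow_le_rpow {a : ℝ} (ha : 0 < a) (m : ℕ) :
    min 1 a * ∑ i ∈ Finset.Icc 1 m, (i : ℝ) ^ (a - 1) ≤ (m : ℝ) ^ a := by
  induction m with
  | zero => simp [Real.zero_rpow ha.ne']
  | succ m ih =>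
    rw [Finset.sum_Icc_succ_top (by omega), mul_add]
    linarith [le_succ_rpow_sub ha m]

lemma exists_sum_rpow_le {a : ℝ} (ha : a ≠ 0) :
    ∃ C : ℝ, 0 < C ∧ ∀ n : ℕ, 0 < n →
      ∑ i ∈ Finset.Icc 1 n, (i : ℝ) ^ (a - 1) ≤ C * (n : ℝ) ^ max 0 a := by
  rcases lt_or_gt_of_ne ha with h | h
  · have hs : Summable fun i : ℕ => (i : ℝ) ^ (a - 1) := Real.summable_nat_rpow.2 (by linarith)
    have h0 : 0 ≤ ∑' i : ℕ, (i : ℝ) ^ (a - 1) := tsum_nonneg fun i => by positivity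
    refine ⟨1 + ∑' i : ℕ, (i : ℝ) ^ (a - 1), by linarith, fun n _ => ?_⟩
    rw [max_eq_left h.le, Real.rpow_zero, mul_one]
    linarith [hs.sum_le_tsum (Finset.Icc 1 n) fun i _ => by positivity]
  · have hm : 0 < min 1 a := lt_min one_pos h
    refine ⟨(min 1 a)⁻¹, by positivity, fun n _ => ?_⟩
    rw [max_eq_right h.le, ← div_eq_inv_mul, le_div_iff₀' hm]
    exact sum_rpow_le_rpow h n

lemma exists_rpow_mul_le_weightedNorm {s : ℝ} {u : ℝ≥0∞} (hu : 0 < u) :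
    ∃ C : ℝ, 0 < C ∧ ∀ (n : ℕ) (g : ℕ → ℝ), (∀ i, 0 ≤ g i) →
      (∀ i j, 1 ≤ i → i ≤ j → g j ≤ g i) → ∀ m ∈ Finset.Icc 1 n,
        (m : ℝ) ^ s * g m ≤ C * weightedNorm n u (fun i => (i : ℝ) ^ s * g i) := by
  by_cases hut : u = ⊤
  · subst hut
    refine ⟨1, one_pos, fun n g _ _ m hm => ?_⟩
    rw [one_mul]
    exact le_weightedNorm_top (y := fun i => (i : ℝ) ^ s * g i) hm
  have hu' : 0 < u.toReal := ENNReal.toReal_pos hu.ne' hut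
  set a := s * u.toReal with ha
  refine ⟨max 1 a ^ (u.toReal)⁻¹, Real.rpow_pos_of_pos (by positivity) _,
    fun n g hg0 hg m hm => ?_⟩
  obtain ⟨hm1, hmn⟩ := Finset.mem_Icc.1 hm
  have hy : ∀ i : ℕ, 0 ≤ (i : ℝ) ^ s * g i := fun i => mul_nonneg (by positivity) (hg0 i)
  have hN := weightedNorm_nonneg (n := n) (u := u) hy
  refine (Real.rpow_le_rpow_iff (hy m) (by positivity) hu').1 ?_
  rw [Real.mul_rpow (by positivity) hN, ← Real.rpow_mul (by positivity),
    inv_mul_cancel₀ hu'.ne', Real.rpow_one, weightedNorm_rpow hu hut hy,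
    Real.mul_rpow (by positivity) (hg0 m), ← Real.rpow_mul (by positivity), ← ha]
  have hgm : 0 ≤ g m ^ u.toReal := Real.rpow_nonneg (hg0 m) _
  calc (m : ℝ) ^ a * g m ^ u.toReal
      ≤ (max 1 a * ∑ i ∈ Finset.Icc 1 m, (i : ℝ) ^ (a - 1)) * g m ^ u.toReal :=
        mul_le_mul_of_nonneg_right (rpow_le_sum_rpow a hm1) hgm
    _ = max 1 a * ∑ i ∈ Finset.Icc 1 m, (i : ℝ) ^ (a - 1) * g m ^ u.toReal := by
        rw [mul_assoc, Finset.sum_mul]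
    _ ≤ max 1 a * ∑ i ∈ Finset.Icc 1 m, (i : ℝ)⁻¹ * ((i : ℝ) ^ s * g i) ^ u.toReal := by
        refine mul_le_mul_of_nonneg_left (Finset.sum_le_sum fun i hi => ?_) (by positivity)
        obtain ⟨hi1, him⟩ := Finset.mem_Icc.1 hi
        have hi0 : (0 : ℝ) < i := by exact_mod_cast hi1
        rw [Real.mul_rpow (by positivity) (hg0 i), ← Real.rpow_mul hi0.le, ← ha, ← mul_assoc,
          ← div_eq_inv_mul, ← Real.rpow_sub_one hi0.ne']
        exact mul_le_mul_of_nonneg_left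
          (Real.rpow_le_rpow (hg0 m) (hg i m hi1 him) hu'.le) (by positivity)
    _ ≤ _ := by
        refine mul_le_mul_of_nonneg_left (Finset.sum_le_sum_of_subset_of_nonneg
          (Finset.Icc_subset_Icc_right hmn) fun i _ _ =>
            mul_nonneg (by positivity) (Real.rpow_nonneg (hy i) _)) (by positivity)

lemma exists_weightedNorm_rpow_le {s : ℝ} (hs : s ≠ 0) {v : ℝ≥0∞} (hv : 0 < v) :
    ∃ C : ℝ, 0 < C ∧ ∀ n : ℕ, 0 < n →
      weightedNorm n v (fun i => (i : ℝ) ^ s) ≤ C * (n : ℝ) ^ max 0 s := by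
  by_cases hvt : v = ⊤
  · subst hvt
    refine ⟨1, one_pos, fun n hn => ?_⟩
    rw [one_mul]
    refine weightedNorm_top_le (by positivity) fun i hi => ?_
    obtain ⟨hi1, hin⟩ := Finset.mem_Icc.1 hi
    have hi1' : (1 : ℝ) ≤ i := by exact_mod_cast hi1
    exact (Real.rpow_le_rpow_of_exponent_le hi1' (le_max_right 0 s)).trans
      (Real.rpow_le_rpow (by positivity) (by exact_mod_cast hin) (le_max_left _ _))
  have hv' : 0 < v.toReal := ENNReal.toReal_pos hv.ne' hvt
  obtain ⟨C, hC, h⟩ := exists_sum_rpow_le (mul_ne_zero hs hv'.ne')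
  refine ⟨C ^ v.toReal⁻¹, by positivity, fun n hn => ?_⟩
  have hy : ∀ i : ℕ, 0 ≤ (i : ℝ) ^ s := fun i => by positivity
  refine (Real.rpow_le_rpow_iff (weightedNorm_nonneg hy) (by positivity) hv').1 ?_
  rw [weightedNorm_rpow hv hvt hy, Real.mul_rpow (by positivity) (by positivity),
    ← Real.rpow_mul hC.le, inv_mul_cancel₀ hv'.ne', Real.rpow_one,
    ← Real.rpow_mul (by positivity), max_mul_of_nonneg _ _ hv'.le, zero_mul]
  refine le_trans (le_of_eq (Finset.sum_congr rfl fun i hi => ?_)) (h n hn)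
  have hi0 : (0 : ℝ) < i := by exact_mod_cast (Finset.mem_Icc.1 hi).1
  rw [← Real.rpow_mul hi0.le, ← div_eq_inv_mul, ← Real.rpow_sub_one hi0.ne']

lemma exists_rpow_le_weightedNorm_rpow {s : ℝ} {v : ℝ≥0∞} (hv : 0 < v) :
    ∃ c : ℝ, 0 < c ∧ ∀ n : ℕ, 0 < n →
      c * (n : ℝ) ^ s ≤ weightedNorm n v (fun i => (i : ℝ) ^ s) := by
  obtain ⟨C, hC, h⟩ := exists_rpow_mul_le_weightedNorm (s := s) hv
  refine ⟨C⁻¹, by positivity, fun n hn => ?_⟩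
  have := h n (fun _ => 1) (fun _ => zero_le_one) (fun _ _ _ _ => le_rfl) n
    (Finset.mem_Icc.2 ⟨hn, le_rfl⟩)
  simp only [mul_one] at this
  rwa [inv_mul_le_iff₀ hC]

lemma weightedNorm_le_of_exponent_ge {n : ℕ} {u v : ℝ≥0∞} (hu : 0 < u) (huv : u ≤ v)
    {y : ℕ → ℝ} (hy : ∀ i, 0 ≤ y i) {C : ℝ} (hC : 1 ≤ C)
    (h : ∀ i ∈ Finset.Icc 1 n, y i ≤ C * weightedNorm n u y) :
    weightedNorm n v y ≤ C * weightedNorm n u y := by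
  have hN := weightedNorm_nonneg (n := n) (u := u) hy
  by_cases hvt : v = ⊤
  · subst hvt
    exact weightedNorm_top_le (by positivity) h
  have hut : u ≠ ⊤ := fun h => hvt (top_le_iff.1 (h ▸ huv))
  have hv : 0 < v := hu.trans_le huv
  have hu' : 0 < u.toReal := ENNReal.toReal_pos hu.ne' hut
  have hv' : 0 < v.toReal := ENNReal.toReal_pos hv.ne' hvt
  have huv' : u.toReal ≤ v.toReal := (ENNReal.toReal_le_toReal hut hvt).2 huv
  refine (Real.rpow_le_rpow_iff (weightedNorm_nonneg hy) (by positivity) hv').1 ?_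
  rw [weightedNorm_rpow hv hvt hy]
  set M := C * weightedNorm n u y with hM
  have hM0 : 0 ≤ M := by positivity
  have hsplit : ∀ {x : ℝ}, 0 ≤ x → x ^ v.toReal = x ^ (v.toReal - u.toReal) * x ^ u.toReal :=
    fun hx => by rw [← Real.rpow_add_of_nonneg hx (by linarith) hu'.le, sub_add_cancel]
  calc ∑ i ∈ Finset.Icc 1 n, (i : ℝ)⁻¹ * y i ^ v.toReal
      ≤ ∑ i ∈ Finset.Icc 1 n, M ^ (v.toReal - u.toReal) * ((i : ℝ)⁻¹ * y i ^ u.toReal) := by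
        refine Finset.sum_le_sum fun i hi => ?_
        rw [hsplit (hy i), mul_left_comm]
        refine mul_le_mul_of_nonneg_right ?_
          (mul_nonneg (by positivity) (Real.rpow_nonneg (hy i) _))
        exact Real.rpow_le_rpow (hy i) (h i hi) (by linarith)
    _ = M ^ (v.toReal - u.toReal) * weightedNorm n u y ^ u.toReal := by
        rw [← Finset.mul_sum, weightedNorm_rpow hu hut hy]
    _ ≤ M ^ (v.toReal - u.toReal) * M ^ u.toReal := by
        refine mul_le_mul_of_nonneg_left (Real.rpow_le_rpow hN ?_ hu'.le) (by positivity)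
        exact le_mul_of_one_le_left hN hC
    _ = M ^ v.toReal := (hsplit hM0).symm

lemma weightedNorm_le_of_exponent_le {n : ℕ} (hn : 0 < n) {u v : ℝ≥0∞} (hv : 0 < v)
    (hvu : v ≤ u) {y : ℕ → ℝ} (hy : ∀ i, 0 ≤ y i) :
    weightedNorm n v y ≤
      (∑ i ∈ Finset.Icc 1 n, (i : ℝ)⁻¹) ^ ((1 / v).toReal - (1 / u).toReal) *
        weightedNorm n u y := by
  have hu : 0 < u := hv.trans_le hvu
  have hN := weightedNorm_nonneg (n := n) (u := u) hy
  by_cases hut : u = ⊤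
  · subst hut
    have h := weightedNorm_mono (u := v) hy (fun _ => mul_nonneg hN zero_le_one)
      (fun i hi => (le_weightedNorm_top hi).trans (mul_one (weightedNorm n ⊤ y)).ge)
    refine h.trans ((weightedNorm_mul_le hv (fun _ => zero_le_one) hN).trans ?_)
    rw [weightedNorm_one hn]
    simp [mul_comm]
  have hvt : v ≠ ⊤ := fun h => hut (top_le_iff.1 (h ▸ hvu))
  have hu' : 0 < u.toReal := ENNReal.toReal_pos hu.ne' hut
  have hv' : 0 < v.toReal := ENNReal.toReal_pos hv.ne' hvt
  have hvu' : v.toReal ≤ u.toReal := (ENNReal.toReal_le_toReal hvt hut).2 hvu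
  have hS : (0 : ℝ) ≤ ∑ i ∈ Finset.Icc 1 n, (i : ℝ)⁻¹ :=
    Finset.sum_nonneg fun i _ => by positivity
  refine (Real.rpow_le_rpow_iff (weightedNorm_nonneg hy) (by positivity) hv').1 ?_
  rw [Real.mul_rpow (by positivity) hN, weightedNorm_rpow hv hvt hy]
  have key := Real.inner_le_weight_mul_Lp_of_nonneg (Finset.Icc 1 n)
    (p := u.toReal / v.toReal) ((one_le_div hv').2 hvu') (fun i => (i : ℝ)⁻¹)
    (fun i => y i ^ v.toReal) (fun i => by positivity) (fun i => Real.rpow_nonneg (hy i) _)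
  refine key.trans (le_of_eq ?_)
  have hpow : ∀ i, (y i ^ v.toReal) ^ (u.toReal / v.toReal) = y i ^ u.toReal := fun i => by
    rw [← Real.rpow_mul (hy i), mul_div_cancel₀ _ hv'.ne']
  simp only [hpow]
  rw [← weightedNorm_rpow hu hut hy, ← Real.rpow_mul hN, ← Real.rpow_mul hS]
  congr 2
  · simp only [ENNReal.toReal_div, ENNReal.toReal_one]
    field_simp
  · field_simp

lemma log_add_one_le_sum_inv (n : ℕ) :
    Real.log ((n : ℝ) + 1) ≤ ∑ i ∈ Finset.Icc 1 n, (i : ℝ)⁻¹ := by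
  have h := log_add_one_le_harmonic n
  rw [harmonic_eq_sum_Icc] at h
  push_cast at h
  exact h

lemma log_natCast_add_one_pos {n : ℕ} (hn : 0 < n) : 0 < Real.log ((n : ℝ) + 1) :=
  Real.log_pos (by simpa using hn)

lemma sum_inv_le_log_add_one {n : ℕ} (hn : 0 < n) :
    ∑ i ∈ Finset.Icc 1 n, (i : ℝ)⁻¹ ≤ ((Real.log 2)⁻¹ + 1) * Real.log ((n : ℝ) + 1) := by
  have h := harmonic_le_one_add_log n
  rw [harmonic_eq_sum_Icc] at h
  push_cast at h
  have hn' : (1 : ℝ) ≤ n := by exact_mod_cast hn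
  have h2 : 0 < Real.log 2 := Real.log_pos one_lt_two
  have h3 : Real.log 2 ≤ Real.log ((n : ℝ) + 1) := Real.log_le_log two_pos (by linarith)
  have h4 : Real.log n ≤ Real.log ((n : ℝ) + 1) := Real.log_le_log (by linarith) (by linarith)
  have h5 : 1 ≤ (Real.log 2)⁻¹ * Real.log ((n : ℝ) + 1) := by
    rwa [← div_eq_inv_mul, one_le_div h2]
  linarith

lemma log_add_one_le_mul_rpow {ε : ℝ} (hε : 0 < ε) {i n : ℕ} (hi : 1 ≤ i) (hin : i ≤ n) :
    Real.log ((n : ℝ) + 1) ≤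
      (1 + (ε * Real.log 2)⁻¹) * ((n : ℝ) / i) ^ ε * Real.log ((i : ℝ) + 1) := by
  have hi' : (1 : ℝ) ≤ i := by exact_mod_cast hi
  have hin' : (i : ℝ) ≤ n := by exact_mod_cast hin
  have h2 : 0 < Real.log 2 := Real.log_pos one_lt_two
  have hL : Real.log 2 ≤ Real.log ((i : ℝ) + 1) := Real.log_le_log two_pos (by linarith)
  have hr : 1 ≤ (n : ℝ) / i := (one_le_div (by linarith)).2 hin'
  have hrε : 1 ≤ ((n : ℝ) / i) ^ ε := Real.one_le_rpow hr hε.le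
  have h1 : Real.log ((n : ℝ) + 1) ≤ Real.log ((n : ℝ) / i) + Real.log ((i : ℝ) + 1) := by
    rw [← Real.log_mul (by positivity) (by positivity)]
    refine Real.log_le_log (by positivity) ?_
    rw [mul_add, div_mul_cancel₀ _ (by positivity)]
    linarith
  have h3 : Real.log ((n : ℝ) / i) ≤ ((n : ℝ) / i) ^ ε / ε :=
    Real.log_le_rpow_div (by linarith) hε
  have h4 : ((n : ℝ) / i) ^ ε / ε ≤
      (ε * Real.log 2)⁻¹ * ((n : ℝ) / i) ^ ε * Real.log ((i : ℝ) + 1) := by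
    have : ((n : ℝ) / i) ^ ε / ε = (ε * Real.log 2)⁻¹ * ((n : ℝ) / i) ^ ε * Real.log 2 := by
      field_simp
    rw [this]
    exact mul_le_mul_of_nonneg_left hL (by positivity)
  have h5 : Real.log ((i : ℝ) + 1) ≤ ((n : ℝ) / i) ^ ε * Real.log ((i : ℝ) + 1) :=
    le_mul_of_one_le_left (by linarith) hrε
  linarith

lemma weightedNorm_mono_index {m n : ℕ} (hmn : m ≤ n) {u : ℝ≥0∞} {y : ℕ → ℝ}
    (hy : ∀ i, 0 ≤ y i) : weightedNorm m u y ≤ weightedNorm n u y := by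
  by_cases hut : u = ⊤
  · subst hut
    exact weightedNorm_top_le (weightedNorm_nonneg hy)
      fun i hi => le_weightedNorm_top (Finset.Icc_subset_Icc_right hmn hi)
  · rw [weightedNorm_of_ne_top hut, weightedNorm_of_ne_top hut]
    exact Real.rpow_le_rpow (weightedNorm_sum_nonneg hy)
      (Finset.sum_le_sum_of_subset_of_nonneg (Finset.Icc_subset_Icc_right hmn)
        fun i _ _ => mul_nonneg (by positivity) (Real.rpow_nonneg (hy i) _)) (by positivity)

lemma mul_log_rpow_le_weightedNorm {n : ℕ} {u : ℝ≥0∞} (hu : 0 < u) {g : ℕ → ℝ}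
    (hg0 : ∀ i, 0 ≤ g i) (hg : ∀ i j, 1 ≤ i → i ≤ j → g j ≤ g i) {m : ℕ}
    (hm : m ∈ Finset.Icc 1 n) :
    g m * Real.log ((m : ℝ) + 1) ^ (1 / u).toReal ≤ weightedNorm n u g := by
  obtain ⟨hm1, hmn⟩ := Finset.mem_Icc.1 hm
  rcases (hg0 m).eq_or_lt with h0 | hpos
  · rw [← h0, zero_mul]
    exact weightedNorm_nonneg hg0
  calc g m * Real.log ((m : ℝ) + 1) ^ (1 / u).toReal
      ≤ g m * (∑ i ∈ Finset.Icc 1 m, (i : ℝ)⁻¹) ^ (1 / u).toReal :=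
        mul_le_mul_of_nonneg_left (Real.rpow_le_rpow (log_natCast_add_one_pos hm1).le
          (log_add_one_le_sum_inv m) ENNReal.toReal_nonneg) hpos.le
    _ = weightedNorm m u (fun _ => g m * 1) := by
        rw [weightedNorm_mul hu (fun _ => zero_le_one) hpos, weightedNorm_one hm1]
    _ ≤ weightedNorm m u g := by
        refine weightedNorm_mono (fun _ => mul_nonneg hpos.le zero_le_one) hg0 fun i hi => ?_
        obtain ⟨hi1, him⟩ := Finset.mem_Icc.1 hi
        simpa using hg i m hi1 him
    _ ≤ weightedNorm n u g := weightedNorm_mono_index hmn hg0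

lemma exists_weightedNorm_le_log {σ : ℝ} (hσ : 0 < σ) {u v : ℝ≥0∞} (hu : 0 < u) (hv : 0 < v) :
    ∃ C : ℝ, 0 < C ∧ ∀ n : ℕ, 0 < n → ∀ g : ℕ → ℝ, (∀ i, 0 ≤ g i) →
      (∀ i j, 1 ≤ i → i ≤ j → g j ≤ g i) → weightedNorm n u g ≤ 1 →
        weightedNorm n v (fun i => (i : ℝ) ^ σ * g i) ≤
          C * ((n : ℝ) ^ σ * Real.log ((n : ℝ) + 1) ^ (-(1 / u).toReal)) := by
  set γ := (1 / u).toReal with hγ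
  have hγ0 : 0 ≤ γ := ENNReal.toReal_nonneg
  set ε := σ / (γ + 1) with hε
  have hε0 : 0 < ε := by positivity
  have hδ : 0 < σ - ε * γ := by
    have : σ - ε * γ = ε := by
      rw [hε]
      field_simp
      ring
    rwa [this]
  set K := 1 + (ε * Real.log 2)⁻¹ with hK
  have hK0 : 0 < K := by
    have : 0 < Real.log 2 := Real.log_pos one_lt_two
    positivity
  obtain ⟨C, hC, hCn⟩ := exists_weightedNorm_rpow_le hδ.ne' hv
  refine ⟨K ^ γ * C, by positivity, fun n hn g hg0 hg hg1 => ?_⟩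
  have hn0 : (0 : ℝ) < n := by exact_mod_cast hn
  have hlog := log_natCast_add_one_pos hn
  set A := K ^ γ * Real.log ((n : ℝ) + 1) ^ (-γ) * (n : ℝ) ^ (ε * γ) with hA
  have hA0 : 0 < A := by positivity
  have hpt : ∀ m ∈ Finset.Icc 1 n, (m : ℝ) ^ σ * g m ≤ A * (m : ℝ) ^ (σ - ε * γ) := by
    intro m hm
    obtain ⟨hm1, hmn⟩ := Finset.mem_Icc.1 hm
    have hm0 : (0 : ℝ) < m := by exact_mod_cast hm1
    have hlm := log_natCast_add_one_pos hm1
    have h1 := (mul_log_rpow_le_weightedNorm hu hg0 hg hm).trans hg1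
    have h2 := Real.rpow_le_rpow hlog.le (log_add_one_le_mul_rpow hε0 hm1 hmn) hγ0
    rw [Real.mul_rpow (by positivity) hlm.le, Real.mul_rpow (by positivity) (by positivity),
      ← Real.rpow_mul (by positivity), Real.div_rpow hn0.le hm0.le] at h2
    have h3 : g m * Real.log ((n : ℝ) + 1) ^ γ ≤
        K ^ γ * ((n : ℝ) ^ (ε * γ) / (m : ℝ) ^ (ε * γ)) := by
      refine (mul_le_mul_of_nonneg_left h2 (hg0 m)).trans ?_
      calc _ = K ^ γ * ((n : ℝ) ^ (ε * γ) / (m : ℝ) ^ (ε * γ)) *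
            (g m * Real.log ((m : ℝ) + 1) ^ γ) := by ring
        _ ≤ _ := mul_le_of_le_one_right (by positivity) h1
    rw [← le_div_iff₀ (by positivity)] at h3
    refine (mul_le_mul_of_nonneg_left h3 (by positivity)).trans (le_of_eq ?_)
    rw [hA, Real.rpow_neg hlog.le, Real.rpow_sub hm0]
    field_simp
  refine (weightedNorm_mono (fun i => mul_nonneg (by positivity) (hg0 i))
    (fun i => by positivity) hpt).trans ?_
  refine (weightedNorm_mul_le hv (fun i => by positivity) hA0.le).trans
    ((mul_le_mul_of_nonneg_left (hCn n hn) hA0.le).trans (le_of_eq ?_))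
  rw [max_eq_right hδ.le, Real.rpow_sub hn0, hA]
  field_simp

lemma lorentzNorm_of_antitone {n : ℕ} {p u : ℝ≥0∞} {f : ℕ → ℝ} (hf0 : ∀ i, 0 ≤ f i)
    (hf : ∀ i j, 1 ≤ i → i ≤ j → f j ≤ f i) :
    lorentzNorm n p u (fun j => f (j + 1)) =
      weightedNorm n u (fun i => (i : ℝ) ^ (1 / p).toReal * f i) := by
  rw [lorentzNorm_eq_weightedNorm]
  exact weightedNorm_congr fun i hi => by rw [rearr_of_antitone hf0 hf hi]

lemma opNorm_le_of_antitone {n : ℕ} {p q u v : ℝ≥0∞} {B : ℝ} (hB : 0 ≤ B)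
    (h : ∀ g : ℕ → ℝ, (∀ i, 0 ≤ g i) → (∀ i j, 1 ≤ i → i ≤ j → g j ≤ g i) →
      weightedNorm n u (fun i => (i : ℝ) ^ (1 / p).toReal * g i) ≤ 1 →
      weightedNorm n v (fun i => (i : ℝ) ^ (1 / q).toReal * g i) ≤ B) :
    (∀ x, lorentzNorm n p u x ≤ 1 → lorentzNorm n q v x ≤ B) ∧
      opNorm n (lorentzNorm n p u) (lorentzNorm n q v) ≤ B := by
  have hx : ∀ x, lorentzNorm n p u x ≤ 1 → lorentzNorm n q v x ≤ B := fun x hx => by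
    rw [lorentzNorm_eq_weightedNorm] at hx ⊢
    exact h _ (rearr_nonneg n x) (fun i j _ hij => rearr_antitone n x hij) hx
  exact ⟨hx, Real.sSup_le (by rintro _ ⟨x, hx1, rfl⟩; exact hx x hx1) hB⟩

lemma le_opNorm_of_antitone {n : ℕ} {p q u v : ℝ≥0∞} (hu : 0 < u) (hv : 0 < v) {B : ℝ}
    (hB : ∀ x, lorentzNorm n p u x ≤ 1 → lorentzNorm n q v x ≤ B) {f : ℕ → ℝ}
    (hf0 : ∀ i, 0 ≤ f i) (hf : ∀ i j, 1 ≤ i → i ≤ j → f j ≤ f i) {L D : ℝ} (hL : 0 < L)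
    (hfL : weightedNorm n u (fun i => (i : ℝ) ^ (1 / p).toReal * f i) ≤ L)
    (hD : D * L ≤ weightedNorm n v (fun i => (i : ℝ) ^ (1 / q).toReal * f i)) :
    D ≤ opNorm n (lorentzNorm n p u) (lorentzNorm n q v) := by
  have hL' : 0 < L⁻¹ := inv_pos.2 hL
  have hscale : ∀ r w : ℝ≥0∞, 0 < w → lorentzNorm n r w (fun j => L⁻¹ * f (j + 1)) =
      L⁻¹ * weightedNorm n w (fun i => (i : ℝ) ^ (1 / r).toReal * f i) := fun r w hw => by
    rw [lorentzNorm_of_antitone (f := fun i => L⁻¹ * f i)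
      (fun i => mul_nonneg hL'.le (hf0 i))
      (fun i j hi hij => mul_le_mul_of_nonneg_left (hf i j hi hij) hL'.le),
      ← weightedNorm_mul hw (fun i => mul_nonneg (by positivity) (hf0 i)) hL']
    simp only [mul_left_comm]
  have hmem : lorentzNorm n p u (fun j => L⁻¹ * f (j + 1)) ≤ 1 := by
    rwa [hscale p u hu, inv_mul_le_iff₀ hL, mul_one]
  refine le_trans ?_ (le_csSup ⟨B, ?_⟩ ⟨_, hmem, rfl⟩)
  · rwa [hscale q v hv, ← div_eq_inv_mul, le_div_iff₀ hL]
  · rintro _ ⟨x, hx, rfl⟩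
    exact hB x hx

lemma one_le_opNorm {n : ℕ} (hn : 0 < n) {p q u v : ℝ≥0∞} (hu : 0 < u) (hv : 0 < v) {B : ℝ}
    (hB : ∀ x, lorentzNorm n p u x ≤ 1 → lorentzNorm n q v x ≤ B) :
    1 ≤ opNorm n (lorentzNorm n p u) (lorentzNorm n q v) := by
  have h : ∀ r w : ℝ≥0∞, 0 < w → weightedNorm n w
      (fun i => (i : ℝ) ^ (1 / r).toReal * if i ≤ 1 then 1 else 0) = 1 := fun r w hw => by
    refine (weightedNorm_congr fun i hi => ?_).trans (weightedNorm_indicator hn hw)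
    have := (Finset.mem_Icc.1 hi).1
    by_cases h1 : i ≤ 1
    · obtain rfl : i = 1 := by omega
      simp
    · simp [h1]
  refine le_opNorm_of_antitone hu hv hB (f := fun i => if i ≤ 1 then 1 else 0) (L := 1)
    (fun i => by split_ifs <;> norm_num) (fun i j hi hij => ?_) one_pos (h p u hu).le
    (by rw [h q v hv, one_mul])
  by_cases hj : j ≤ 1
  · simp [hj, hij.trans hj]
  · simp only [hj, if_false]
    split_ifs <;> norm_num

lemma toReal_one_div_pos {p : ℝ≥0∞} (hp : 0 < p) (hpt : p ≠ ⊤) : 0 < (1 / p).toReal := by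
  rw [one_div, ENNReal.toReal_inv]
  exact inv_pos.2 (ENNReal.toReal_pos hp.ne' hpt)

lemma toReal_one_div_le {p q : ℝ≥0∞} (hp : 0 < p) (hpq : p ≤ q) :
    (1 / q).toReal ≤ (1 / p).toReal := by
  refine ENNReal.toReal_mono ?_ (ENNReal.div_le_div_left hpq 1)
  simp [hp.ne']

lemma toReal_one_div_ne {p q : ℝ≥0∞} (hp : 0 < p) (hq : 0 < q) (hpq : p ≠ q) :
    (1 / q).toReal ≠ (1 / p).toReal := by
  intro h
  rw [ENNReal.toReal_eq_toReal_iff' (by simp [hq.ne']) (by simp [hp.ne'])] at h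
  simp only [one_div, inv_inj] at h
  exact hpq h.symm

lemma exists_opNorm_le_rpow {p q u v : ℝ≥0∞} (hp : 0 < p) (hq : 0 < q) (hu : 0 < u)
    (hv : 0 < v) (hpq : p ≠ q) :
    ∃ C : ℝ, 0 < C ∧ ∀ n : ℕ, 0 < n →
      (∀ x, lorentzNorm n p u x ≤ 1 → lorentzNorm n q v x ≤
        C * (n : ℝ) ^ max 0 ((1 / q).toReal - (1 / p).toReal)) ∧
      opNorm n (lorentzNorm n p u) (lorentzNorm n q v) ≤
        C * (n : ℝ) ^ max 0 ((1 / q).toReal - (1 / p).toReal) := by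
  obtain ⟨C₁, hC₁, h₁⟩ := exists_rpow_mul_le_weightedNorm (s := (1 / p).toReal) hu
  obtain ⟨C₂, hC₂, h₂⟩ :=
    exists_weightedNorm_rpow_le (sub_ne_zero.2 (toReal_one_div_ne hp hq hpq)) hv
  refine ⟨C₁ * C₂, by positivity, fun n hn =>
    opNorm_le_of_antitone (by positivity) fun g hg0 hg hg1 => ?_⟩
  have hpt : ∀ i ∈ Finset.Icc 1 n, (i : ℝ) ^ (1 / q).toReal * g i ≤
      C₁ * (i : ℝ) ^ ((1 / q).toReal - (1 / p).toReal) := fun i hi => by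
    have hi0 : (0 : ℝ) < i := by exact_mod_cast (Finset.mem_Icc.1 hi).1
    have h := (h₁ n g hg0 hg i hi).trans (mul_le_of_le_one_right hC₁.le hg1)
    calc (i : ℝ) ^ (1 / q).toReal * g i
        = (i : ℝ) ^ ((1 / q).toReal - (1 / p).toReal) * ((i : ℝ) ^ (1 / p).toReal * g i) := by
          rw [← mul_assoc, ← Real.rpow_add hi0, sub_add_cancel]
      _ ≤ (i : ℝ) ^ ((1 / q).toReal - (1 / p).toReal) * C₁ :=
          mul_le_mul_of_nonneg_left h (by positivity)
      _ = _ := mul_comm _ _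
  refine (weightedNorm_mono (fun i => mul_nonneg (by positivity) (hg0 i))
    (fun i => by positivity) hpt).trans ?_
  refine (weightedNorm_mul_le hv (fun i => by positivity) hC₁.le).trans ?_
  rw [mul_assoc]
  exact mul_le_mul_of_nonneg_left (h₂ n hn) hC₁.le

lemma opNorm_lorentz_of_ne {p q u v : ℝ≥0∞} (hp : 0 < p) (hq : 0 < q) (hu : 0 < u)
    (hv : 0 < v) (hpq : p ≠ q) (hpt : p ≠ ⊤) :
    ∃ c C : ℝ, 0 < c ∧ 0 < C ∧ ∀ n : ℕ, 0 < n →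
      c * (n : ℝ) ^ max 0 ((1 / q).toReal - (1 / p).toReal) ≤
          opNorm n (lorentzNorm n p u) (lorentzNorm n q v) ∧
        opNorm n (lorentzNorm n p u) (lorentzNorm n q v) ≤
          C * (n : ℝ) ^ max 0 ((1 / q).toReal - (1 / p).toReal) := by
  obtain ⟨C, hC, h⟩ := exists_opNorm_le_rpow hp hq hu hv hpq
  have hp' := toReal_one_div_pos hp hpt
  rcases le_total ((1 / q).toReal) ((1 / p).toReal) with hle | hle
  · refine ⟨1, C, one_pos, hC, fun n hn => ⟨?_, (h n hn).2⟩⟩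
    rw [max_eq_left (by linarith), Real.rpow_zero, mul_one]
    exact one_le_opNorm hn hu hv (h n hn).1
  · obtain ⟨K, hK, hKn⟩ := exists_weightedNorm_rpow_le hp'.ne' hu
    obtain ⟨k, hk, hkn⟩ := exists_rpow_le_weightedNorm_rpow (s := (1 / q).toReal) hv
    refine ⟨k / K, C, by positivity, hC, fun n hn => ⟨?_, (h n hn).2⟩⟩
    have hn0 : (0 : ℝ) < n := by exact_mod_cast hn
    have hKn := hKn n hn
    rw [max_eq_right hp'.le] at hKn
    refine le_opNorm_of_antitone hu hv (h n hn).1 (f := fun _ => 1)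
      (L := K * (n : ℝ) ^ (1 / p).toReal) (fun _ => zero_le_one) (fun _ _ _ _ => le_rfl)
      (by positivity) (by simpa only [mul_one] using hKn) ?_
    simp only [mul_one]
    refine le_trans (le_of_eq ?_) (hkn n hn)
    rw [max_eq_right (by linarith), Real.rpow_sub hn0]
    field_simp

lemma opNorm_lorentz_top_left {q u v : ℝ≥0∞} (hq : 0 < q) (hu : 0 < u) (hv : 0 < v)
    (hqt : q ≠ ⊤) :
    ∃ c C : ℝ, 0 < c ∧ 0 < C ∧ ∀ n : ℕ, 0 < n →
      c * ((n : ℝ) ^ (1 / q).toReal * Real.log ((n : ℝ) + 1) ^ (-(1 / u).toReal)) ≤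
          opNorm n (lorentzNorm n ⊤ u) (lorentzNorm n q v) ∧
        opNorm n (lorentzNorm n ⊤ u) (lorentzNorm n q v) ≤
          C * ((n : ℝ) ^ (1 / q).toReal * Real.log ((n : ℝ) + 1) ^ (-(1 / u).toReal)) := by
  obtain ⟨C, hC, h⟩ := exists_weightedNorm_le_log (toReal_one_div_pos hq hqt) hu hv
  obtain ⟨k, hk, hkn⟩ := exists_rpow_le_weightedNorm_rpow (s := (1 / q).toReal) hv
  set K := (Real.log 2)⁻¹ + 1 with hKdef
  have hK : 0 < K := by
    have : 0 < Real.log 2 := Real.log_pos one_lt_two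
    positivity
  refine ⟨k / K ^ (1 / u).toReal, C, by positivity, hC, fun n hn => ?_⟩
  have hlog := log_natCast_add_one_pos hn
  have hB := opNorm_le_of_antitone (p := ⊤) (q := q) (u := u) (v := v) (n := n)
    (B := C * ((n : ℝ) ^ (1 / q).toReal * Real.log ((n : ℝ) + 1) ^ (-(1 / u).toReal)))
    (by positivity) fun g hg0 hg hg1 => h n hn g hg0 hg (by simpa using hg1)
  refine ⟨le_opNorm_of_antitone hu hv hB.1 (f := fun _ => 1)
    (L := K ^ (1 / u).toReal * Real.log ((n : ℝ) + 1) ^ (1 / u).toReal)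
    (fun _ => zero_le_one) (fun _ _ _ _ => le_rfl) (by positivity) ?_ ?_, hB.2⟩
  · simp only [mul_one, ENNReal.div_top, ENNReal.toReal_zero, Real.rpow_zero]
    rw [weightedNorm_one hn, ← Real.mul_rpow hK.le hlog.le]
    exact Real.rpow_le_rpow (Finset.sum_nonneg fun i _ => by positivity)
      (sum_inv_le_log_add_one hn) ENNReal.toReal_nonneg
  · simp only [mul_one]
    refine le_trans (le_of_eq ?_) (hkn n hn)
    rw [Real.rpow_neg hlog.le]
    field_simp

lemma opNorm_lorentz_same {p u v : ℝ≥0∞} (hu : 0 < u) (hv : 0 < v) :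
    ∃ c C : ℝ, 0 < c ∧ 0 < C ∧ ∀ n : ℕ, 0 < n →
      c * Real.log ((n : ℝ) + 1) ^ max 0 ((1 / v).toReal - (1 / u).toReal) ≤
          opNorm n (lorentzNorm n p u) (lorentzNorm n p v) ∧
        opNorm n (lorentzNorm n p u) (lorentzNorm n p v) ≤
          C * Real.log ((n : ℝ) + 1) ^ max 0 ((1 / v).toReal - (1 / u).toReal) := by
  rcases le_total u v with huv | hvu
  · obtain ⟨C, hC, h⟩ := exists_rpow_mul_le_weightedNorm (s := (1 / p).toReal) hu
    refine ⟨1, max 1 C, one_pos, by positivity, fun n hn => ?_⟩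
    have hle := toReal_one_div_le hu huv
    rw [max_eq_left (by linarith), Real.rpow_zero, mul_one, mul_one]
    have hB := opNorm_le_of_antitone (p := p) (q := p) (u := u) (v := v) (n := n)
      (B := max 1 C) (by positivity) fun g hg0 hg hg1 => by
        have hy : ∀ i : ℕ, 0 ≤ (i : ℝ) ^ (1 / p).toReal * g i :=
          fun i => mul_nonneg (by positivity) (hg0 i)
        refine (weightedNorm_le_of_exponent_ge hu huv hy (le_max_left 1 C)
          fun i hi => ?_).trans (mul_le_of_le_one_right (by positivity) hg1)
        exact (h n g hg0 hg i hi).trans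
          (mul_le_mul_of_nonneg_right (le_max_right 1 C) (weightedNorm_nonneg hy))
    exact ⟨one_le_opNorm hn hu hv hB.1, hB.2⟩
  · have hle := sub_nonneg.2 (toReal_one_div_le hv hvu)
    set t := (1 / v).toReal - (1 / u).toReal with ht
    have h2 : 0 < Real.log 2 := Real.log_pos one_lt_two
    refine ⟨1, ((Real.log 2)⁻¹ + 1) ^ t, one_pos, by positivity, fun n hn => ?_⟩
    have hlog := log_natCast_add_one_pos hn
    have hS : 0 < ∑ i ∈ Finset.Icc 1 n, (i : ℝ)⁻¹ := hlog.trans_le (log_add_one_le_sum_inv n)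
    rw [max_eq_right hle, one_mul]
    have hB := opNorm_le_of_antitone (p := p) (q := p) (u := u) (v := v) (n := n)
      (B := ((Real.log 2)⁻¹ + 1) ^ t * Real.log ((n : ℝ) + 1) ^ t)
      (by positivity) fun g hg0 hg hg1 => by
        have hy : ∀ i : ℕ, 0 ≤ (i : ℝ) ^ (1 / p).toReal * g i :=
          fun i => mul_nonneg (by positivity) (hg0 i)
        refine (weightedNorm_le_of_exponent_le hn hv hvu hy).trans
          ((mul_le_of_le_one_right (by positivity) hg1).trans ?_)
        rw [← Real.mul_rpow (by positivity) hlog.le]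
        exact Real.rpow_le_rpow hS.le (sum_inv_le_log_add_one hn) hle
    have hW : ∀ w : ℝ≥0∞, weightedNorm n w
        (fun i => (i : ℝ) ^ (1 / p).toReal * (i : ℝ) ^ (-(1 / p).toReal)) =
          (∑ i ∈ Finset.Icc 1 n, (i : ℝ)⁻¹) ^ (1 / w).toReal := fun w => by
      rw [← weightedNorm_one hn]
      refine weightedNorm_congr fun i hi => ?_
      have hi0 : (0 : ℝ) < i := by exact_mod_cast (Finset.mem_Icc.1 hi).1
      rw [← Real.rpow_add hi0, add_neg_cancel, Real.rpow_zero]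
    refine ⟨(Real.rpow_le_rpow hlog.le (log_add_one_le_sum_inv n) hle).trans
      (le_opNorm_of_antitone hu hv hB.1 (f := fun i => (i : ℝ) ^ (-(1 / p).toReal))
        (fun i => by positivity) (fun i j hi hij => ?_) (Real.rpow_pos_of_pos hS _) (hW u).le
        ?_), hB.2⟩
    · exact Real.rpow_le_rpow_of_nonpos (by exact_mod_cast hi) (by exact_mod_cast hij)
        (neg_nonpos.2 ENNReal.toReal_nonneg)
    · rw [hW v, ← Real.rpow_add hS, ht, sub_add_cancel]

/-- Asymptotics for the operator norm of the natural identity `id : ℓ_{p,u}^n → ℓ_{q,v}^n`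
between finite-dimensional Lorentz spaces, in all four regimes (with `(x)_+ = max 0 x`). -/
theorem opNorm_lorentz_embedding
    (p q u v : ℝ≥0∞) (hp : 0 < p) (hq : 0 < q) (hu : 0 < u) (hv : 0 < v) :
    ∃ c C : ℝ, 0 < c ∧ 0 < C ∧ ∀ n : ℕ, 0 < n →
      ((p ≠ q ∧ p ≠ ⊤ ∧ q ≠ ⊤) →
        c * (n : ℝ) ^ max 0 ((1 / q).toReal - (1 / p).toReal) ≤
            opNorm n (lorentzNorm n p u) (lorentzNorm n q v) ∧
          opNorm n (lorentzNorm n p u) (lorentzNorm n q v) ≤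
            C * (n : ℝ) ^ max 0 ((1 / q).toReal - (1 / p).toReal)) ∧
      ((q < p ∧ p = ⊤) →
        c * ((n : ℝ) ^ (1 / q).toReal * Real.log ((n : ℝ) + 1) ^ (-(1 / u).toReal)) ≤
            opNorm n (lorentzNorm n p u) (lorentzNorm n q v) ∧
          opNorm n (lorentzNorm n p u) (lorentzNorm n q v) ≤
            C * ((n : ℝ) ^ (1 / q).toReal * Real.log ((n : ℝ) + 1) ^ (-(1 / u).toReal))) ∧
      ((p < q ∧ q = ⊤) →
        c ≤ opNorm n (lorentzNorm n p u) (lorentzNorm n q v) ∧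
          opNorm n (lorentzNorm n p u) (lorentzNorm n q v) ≤ C) ∧
      (p = q →
        c * Real.log ((n : ℝ) + 1) ^ max 0 ((1 / v).toReal - (1 / u).toReal) ≤
            opNorm n (lorentzNorm n p u) (lorentzNorm n q v) ∧
          opNorm n (lorentzNorm n p u) (lorentzNorm n q v) ≤
            C * Real.log ((n : ℝ) + 1) ^ max 0 ((1 / v).toReal - (1 / u).toReal)) := by
  by_cases hpq : p = q
  · subst hpq
    obtain ⟨c, C, hc, hC, h⟩ := opNorm_lorentz_same (p := p) hu hv
    exact ⟨c, C, hc, hC, fun n hn => ⟨fun H => absurd rfl H.1, fun H => absurd H.1 (lt_irrefl _),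
      fun H => absurd H.1 (lt_irrefl _), fun _ => h n hn⟩⟩
  by_cases hpt : p = ⊤
  · subst hpt
    obtain ⟨c, C, hc, hC, h⟩ := opNorm_lorentz_top_left hq hu hv (Ne.symm hpq)
    exact ⟨c, C, hc, hC, fun n hn => ⟨fun H => absurd rfl H.2.1, fun _ => h n hn,
      fun H => absurd H.1 not_top_lt, fun H => absurd H hpq⟩⟩
  obtain ⟨c, C, hc, hC, h⟩ := opNorm_lorentz_of_ne hp hq hu hv hpq hpt
  refine ⟨c, C, hc, hC, fun n hn => ⟨fun _ => h n hn, fun H => absurd H.2 hpt, fun H => ?_,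
    fun H => absurd H hpq⟩⟩
  have hle := toReal_one_div_le hp H.1.le
  simpa only [max_eq_left (sub_nonpos.2 hle), Real.rpow_zero, mul_one] using h n hn
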